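/- Let σ_X > 0, R, R_c ∈ [0,∞], and P ∈ [0,∞). The strict inequality D̲'(R,R_c,P|W₂²) > D̲(R,R_c,P|W₂²) holds if and only if R ∈ (0,∞), R_c ∈ (0,∞), and 0 < P < σ_X² (2 − e^{−2R} − 2√((1 − e^{−2R})(1 − e^{−2(R+R_c)}))). -/

import Mathlib

open MeasureTheory ProbabilityTheory Real Set
open scoped ENNReal NNReal

noncomputable section

open Classical in
/-- Kullback-Leibler divergence of `q` from `p`, in `[0,∞]`. -/
def KLD {α : Type*} [MeasurableSpace α] (q p : Measure α) : ℝ≥0∞ :=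
  if q ≪ p ∧ Integrable (fun x => Real.log (q.rnDeriv p x).toReal) q
  then ENNReal.ofReal (∫ x, Real.log (q.rnDeriv p x).toReal ∂q) else ⊤

/-- Mutual information between `f` and `g` under `μ`. -/
def mutInfo {Ω α β : Type*} [MeasurableSpace Ω] [MeasurableSpace α] [MeasurableSpace β]
    (μ : Measure Ω) (f : Ω → α) (g : Ω → β) : ℝ≥0∞ :=
  KLD (μ.map (fun ω => (f ω, g ω))) ((μ.map f).prod (μ.map g))

/-- Squared Wasserstein-2 distance. -/
def W2sq (p q : Measure ℝ) : ℝ≥0∞ :=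
  ⨅ (cpl : Measure (ℝ × ℝ)) (_ : IsProbabilityMeasure cpl) (_ : cpl.map Prod.fst = p)
    (_ : cpl.map Prod.snd = q), ∫⁻ xy, ENNReal.ofReal ((xy.1 - xy.2) ^ 2) ∂cpl

/-- `exp(-x)` for `x ∈ [0,∞]`, with `exp(-∞) = 0`. -/
def expNeg (x : ℝ≥0∞) : ℝ := if x = ⊤ then 0 else Real.exp (-x.toReal)

/-- Feasibility predicate for the distortion-rate-perception function. -/
def DRPfeasible (pX : Measure ℝ) (φ : Measure ℝ → Measure ℝ → ℝ≥0∞) (R Rc P : ℝ≥0∞)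
    (μ : Measure (ℝ × ℝ × ℝ)) : Prop :=
  ∃ hμ : IsProbabilityMeasure μ,
    μ.map (fun w => w.1) = pX ∧
    (haveI := hμ
     CondIndepFun (MeasurableSpace.comap (fun w : ℝ × ℝ × ℝ => w.2.1) inferInstance)
      ((measurable_fst.comp measurable_snd).comap_le)
      (fun w : ℝ × ℝ × ℝ => w.1) (fun w : ℝ × ℝ × ℝ => w.2.2) μ) ∧
    mutInfo μ (fun w => w.1) (fun w => w.2.1) ≤ R ∧
    mutInfo μ (fun w => w.2.2) (fun w => w.2.1) ≤ R + Rc ∧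
    φ pX (μ.map (fun w => w.2.2)) ≤ P

/-- Mean squared distortion of a joint law of `(X, U, X̂)`. -/
def distortion (μ : Measure (ℝ × ℝ × ℝ)) : ℝ≥0∞ :=
  ∫⁻ w, ENNReal.ofReal ((w.1 - w.2.2) ^ 2) ∂μ

/-- The distortion-rate-perception function `D(R, R_c, P | φ)`. -/
def DRP (pX : Measure ℝ) (φ : Measure ℝ → Measure ℝ → ℝ≥0∞) (R Rc P : ℝ≥0∞) : ℝ≥0∞ :=
  ⨅ (μ : Measure (ℝ × ℝ × ℝ)) (_ : DRPfeasible pX φ R Rc P μ), distortion μ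

/-- `D(R, R_c, ∞)`: the DRP function without perception constraint. -/
def DRPinf (pX : Measure ℝ) (R Rc : ℝ≥0∞) : ℝ≥0∞ :=
  DRP pX (fun _ _ => 0) R Rc ⊤

/-- Deterministic-decoder (entropy-constrained quantization) function `D_e(R, R_c)`,
with `H(X̂) := I(X̂; X̂)`. -/
def De (pX : Measure ℝ) (R Rc : ℝ≥0∞) : ℝ≥0∞ :=
  ⨅ (cpl : Measure (ℝ × ℝ)) (_ : IsProbabilityMeasure cpl ∧ cpl.map Prod.fst = pX ∧
      mutInfo cpl Prod.fst Prod.snd ≤ R ∧ mutInfo cpl Prod.snd Prod.snd ≤ R + Rc),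
    ∫⁻ w, ENNReal.ofReal ((w.1 - w.2) ^ 2) ∂cpl

/-- The Gaussian measure `N(μ, σ²)`. -/
def gauss (μ σ : ℝ) : Measure ℝ := gaussianReal μ ⟨σ ^ 2, sq_nonneg σ⟩

end
noncomputable section

/-- `ξ(R, R_c) = √((1 - e^{-2R})(1 - e^{-2(R+R_c)}))`. -/
def xiRRc (R Rc : ℝ≥0∞) : ℝ :=
  Real.sqrt ((1 - expNeg (2 * R)) * (1 - expNeg (2 * (R + Rc))))

/-- `ψ(σ) = log(σ_X/σ) + (σ² - σ_X²)/(2σ_X²)`. -/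
def psi (σX s : ℝ) : ℝ := Real.log (σX / s) + (s ^ 2 - σX ^ 2) / (2 * σX ^ 2)

/-- `δ₊(σ̂, α)` from the improved lower bound. -/
def deltaPlus (σX : ℝ) (R Rc : ℝ≥0∞) (P s α : ℝ) : ℝ :=
  max (σX * expNeg (R + Rc) -
    Real.sqrt (σX ^ 2 - α * (σX ^ 2 + s ^ 2 - P) + α ^ 2 * s ^ 2)) 0 / α

/-- The inner `sup` over `α > 0` in the improved lower bound `D̲'`. -/
def DlowerPrimeFun (σX : ℝ) (R Rc : ℝ≥0∞) (P s : ℝ) : ℝ :=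
  sSup ((fun α => σX ^ 2 + s ^ 2 - 2 * σX *
    Real.sqrt ((1 - expNeg (2 * R)) * (s ^ 2 - deltaPlus σX R Rc P s α ^ 2))) '' Set.Ioi 0)

/-- The improved explicit lower bound `D̲'(R, R_c, P | W₂²)`. -/
def DlowerPrime (σX : ℝ) (R Rc : ℝ≥0∞) (P : ℝ) : ℝ :=
  sInf (DlowerPrimeFun σX R Rc P '' Set.Icc (max (σX - Real.sqrt P) 0) σX)

/-- The explicit lower bound `D̲(R, R_c, P | W₂²)` of Xie et al. -/
def DlowerW2 (σX : ℝ) (R Rc : ℝ≥0∞) (P : ℝ) : ℝ :=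
  sInf ((fun s => σX ^ 2 + s ^ 2 - 2 * σX *
      Real.sqrt ((1 - expNeg (2 * R)) *
        (s ^ 2 - max (σX * expNeg (R + Rc) - Real.sqrt P) 0 ^ 2)))
    '' Set.Icc (max (σX - Real.sqrt P) 0) σX)

end

/-- The basic objective. -/
noncomputable def auxF (σ c s d : ℝ) : ℝ := σ ^ 2 + s ^ 2 - 2 * σ * Real.sqrt (c * (s ^ 2 - d ^ 2))

/-- Real version of `δ₊`. -/
noncomputable def auxD (σ e P s α : ℝ) : ℝ :=
  max (σ * e - Real.sqrt (σ ^ 2 - α * (σ ^ 2 + s ^ 2 - P) + α ^ 2 * s ^ 2)) 0 / α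

lemma auxF_mono {σ c s d d' : ℝ} (hσ : 0 < σ) (hc : 0 ≤ c) (hd : 0 ≤ d) (h : d ≤ d') :
    auxF σ c s d ≤ auxF σ c s d' := by
  unfold auxF
  have : Real.sqrt (c * (s ^ 2 - d' ^ 2)) ≤ Real.sqrt (c * (s ^ 2 - d ^ 2)) := by
    gcongr
  nlinarith

lemma auxF_strict {σ c s d d' : ℝ} (hσ : 0 < σ) (hc : 0 < c) (hd : 0 ≤ d) (h : d < d')
    (hs : 0 < s ^ 2 - d ^ 2) : auxF σ c s d < auxF σ c s d' := by
  unfold auxF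
  have : Real.sqrt (c * (s ^ 2 - d' ^ 2)) < Real.sqrt (c * (s ^ 2 - d ^ 2)) := by
    refine (Real.sqrt_lt_sqrt_iff_of_pos ?_).2 ?_
    · positivity
    · have : d ^ 2 < d' ^ 2 := by gcongr
      nlinarith
  nlinarith

lemma auxF_eq {σ c s d : ℝ} (hc : 0 ≤ c) (h : d ^ 2 ≤ s ^ 2) :
    auxF σ c s d = σ ^ 2 + d ^ 2 - c * σ ^ 2 +
      (Real.sqrt (s ^ 2 - d ^ 2) - σ * Real.sqrt c) ^ 2 := by
  unfold auxF
  rw [Real.sqrt_mul hc]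
  have h1 := Real.sq_sqrt hc
  have h2 := Real.sq_sqrt (sub_nonneg.2 h)
  nlinarith

/-- The minimizer. -/
lemma auxF_min {σ c s d lo ss : ℝ} (hσ : 0 < σ) (hc : 0 ≤ c) (hlo : 0 ≤ lo) (hd : 0 ≤ d)
    (hdl : d ≤ lo) (hss : ss = max lo (Real.sqrt (c * σ ^ 2 + d ^ 2))) (hs : lo ≤ s)
    (hne : s ≠ ss) : auxF σ c ss d < auxF σ c s d := by
  have hs0 : 0 ≤ s := hlo.trans hs
  have hls : lo ≤ ss := hss ▸ le_max_left _ _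
  have hss0 : 0 ≤ ss := hlo.trans hls
  have hds : d ^ 2 ≤ s ^ 2 := by gcongr; linarith
  have hdss : d ^ 2 ≤ ss ^ 2 := by gcongr; linarith
  have hc1 : σ * Real.sqrt c = Real.sqrt (c * σ ^ 2) := by
    rw [Real.sqrt_mul hc, Real.sqrt_sq hσ.le, mul_comm]
  rw [auxF_eq hc hds, auxF_eq hc hdss]
  have hnn : 0 ≤ c * σ ^ 2 + d ^ 2 := by positivity
  have hge : σ * Real.sqrt c ≤ Real.sqrt (ss ^ 2 - d ^ 2) := by
    rw [hc1]
    apply Real.sqrt_le_sqrt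
    have : Real.sqrt (c * σ ^ 2 + d ^ 2) ≤ ss := hss ▸ le_max_right _ _
    have := Real.sqrt_le_iff.1 this
    linarith [this.2]
  rcases le_or_gt (Real.sqrt (c * σ ^ 2 + d ^ 2)) lo with h | h
  · have h1 : ss = lo := by rw [hss, max_eq_left h]
    have h2 : ss < s := lt_of_le_of_ne (h1 ▸ hs) (Ne.symm hne)
    have h3 : Real.sqrt (ss ^ 2 - d ^ 2) < Real.sqrt (s ^ 2 - d ^ 2) := by
      apply Real.sqrt_lt_sqrt (by linarith)
      have : ss ^ 2 < s ^ 2 := by gcongr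
      linarith
    nlinarith
  · have h1 : ss = Real.sqrt (c * σ ^ 2 + d ^ 2) := by rw [hss, max_eq_right h.le]
    have h2 : ss ^ 2 - d ^ 2 = c * σ ^ 2 := by rw [h1, Real.sq_sqrt hnn]; ring
    rw [h2, hc1, sub_self]
    have : Real.sqrt (s ^ 2 - d ^ 2) - Real.sqrt (c * σ ^ 2) ≠ 0 := by
      intro h0
      have h3 := (Real.sqrt_inj (by linarith) (by positivity)).1 (sub_eq_zero.1 h0)
      apply hne
      have : s ^ 2 = ss ^ 2 := by linarith
      exact (sq_eq_sq₀ hs0 hss0).1 this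
    have := sq_pos_of_ne_zero this
    linarith

lemma auxD_one {σ e P s : ℝ} : auxD σ e P s 1 = max (σ * e - Real.sqrt P) 0 := by
  unfold auxD
  rw [div_one]
  congr 3
  ring

/-- Stationary case: `α = 1` is optimal. -/
lemma auxD_le_stat {σ e p s α : ℝ} (he0 : 0 ≤ e) (he1 : e ≤ 1) (hα : 0 < α)
    (hs : s ^ 2 = σ ^ 2 + p ^ 2 - 2 * σ * e * p) :
    auxD σ e (p ^ 2) s α ≤ max (σ * e - p) 0 := by
  unfold auxD
  rw [div_le_iff₀ hα]
  apply max_le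
  · have h1 : σ * e * (1 - α) + α * p ≤
        Real.sqrt (σ ^ 2 - α * (σ ^ 2 + s ^ 2 - p ^ 2) + α ^ 2 * s ^ 2) := by
      apply Real.le_sqrt_of_sq_le
      rw [hs]
      have : 0 ≤ (1 - e ^ 2) * (σ * (1 - α)) ^ 2 := by
        apply mul_nonneg _ (sq_nonneg _)
        nlinarith
      nlinarith
    have h2 : (σ * e - p) * α ≤ max (σ * e - p) 0 * α := by
      gcongr
      exact le_max_left _ _
    nlinarith
  · positivity

/-- Strict improvement at the minimizer. -/
lemma exists_alpha {σ c e p ss : ℝ} (hσ : 0 < σ) (hc : 0 < c) (he : 0 < e)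
    (hce : e ^ 2 < 1 - c) (hp : 0 < p)
    (hT : p ^ 2 < σ ^ 2 * (1 + c - 2 * Real.sqrt (c * (1 - e ^ 2))))
    (hss : ss = max (max (σ - p) 0)
      (Real.sqrt (c * σ ^ 2 + (max (σ * e - p) 0) ^ 2))) :
    ∃ α, 0 < α ∧ max (σ * e - p) 0 < auxD σ e (p ^ 2) ss α := by
  have hnn : 0 < c * σ ^ 2 + (max (σ * e - p) 0) ^ 2 := by positivity
  have hss0 : 0 < ss := by
    rw [hss]
    exact lt_of_lt_of_le (Real.sqrt_pos.2 hnn) (le_max_right _ _)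
  have he1 : e < 1 := by nlinarith
  rcases lt_or_ge p (σ * e) with h | h
  · have hd : max (σ * e - p) 0 = σ * e - p := max_eq_left (by linarith)
    have hA : 0 < σ ^ 2 + p ^ 2 - 2 * σ * e * p - ss ^ 2 := by
      have hpσ : p < σ := by nlinarith
      rw [hd] at hss hnn
      rw [max_eq_left (by linarith : (0:ℝ) ≤ σ - p)] at hss
      rcases max_choice (σ - p) (Real.sqrt (c * σ ^ 2 + (σ * e - p) ^ 2)) with h1 | h1
      · rw [hss, h1]
        have : 0 < σ * p * (1 - e) := by
          apply mul_pos (mul_pos hσ hp); linarith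
        nlinarith
      · rw [hss, h1, Real.sq_sqrt hnn.le]
        have : 0 < σ ^ 2 * (1 - c - e ^ 2) := by
          apply mul_pos (by positivity); linarith
        nlinarith
    rw [hd]
    obtain ⟨A, hAdef⟩ : ∃ A, A = σ ^ 2 + p ^ 2 - 2 * σ * e * p - ss ^ 2 := ⟨_, rfl⟩
    rw [← hAdef] at hA
    obtain ⟨d, hdd⟩ : ∃ d, d = σ * e - p := ⟨_, rfl⟩
    have hd0 : 0 < d := by linarith
    obtain ⟨k, hk, hk1, hk2⟩ : ∃ k, 0 < k ∧ k * ss ^ 2 < A ∧ k * d < p := by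
      refine ⟨min (A / (2 * ss ^ 2)) (p / (2 * d)), by positivity, ?_, ?_⟩
      · calc _ ≤ A / (2 * ss ^ 2) * ss ^ 2 := by gcongr; exact min_le_left _ _
          _ = A / 2 := by field_simp
          _ < A := by linarith
      · calc _ ≤ p / (2 * d) * d := by gcongr; exact min_le_right _ _
          _ = p / 2 := by field_simp
          _ < p := by linarith
    refine ⟨1 + k, by linarith, ?_⟩
    unfold auxD
    rw [lt_div_iff₀ (by linarith)]
    apply lt_of_lt_of_le _ (le_max_left _ _)
    have : Real.sqrt (σ ^ 2 - (1 + k) * (σ ^ 2 + ss ^ 2 - p ^ 2) + (1 + k) ^ 2 * ss ^ 2)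
        < p - k * d := by
      rw [Real.sqrt_lt' (by linarith)]
      have e1 : (p - k * d) ^ 2 - (σ ^ 2 - (1 + k) * (σ ^ 2 + ss ^ 2 - p ^ 2)
          + (1 + k) ^ 2 * ss ^ 2) = k * (A - k * ss ^ 2) + (k * d) ^ 2 := by
        rw [hAdef, hdd]; ring
      have : 0 < k * (A - k * ss ^ 2) := mul_pos hk (by linarith)
      nlinarith [sq_nonneg (k * d)]
    rw [← hdd]
    nlinarith
  · have hd : max (σ * e - p) 0 = 0 := max_eq_right (by linarith)
    rw [hd] at hss ⊢
    have hce' : Real.sqrt (c * σ ^ 2 + 0 ^ 2) = σ * Real.sqrt c := by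
      rw [zero_pow two_ne_zero, add_zero, Real.sqrt_mul hc.le, Real.sqrt_sq hσ.le, mul_comm]
    rw [hce'] at hss
    have h1e : 0 < 1 - e ^ 2 := by linarith
    obtain ⟨r, hr⟩ : ∃ r, r = Real.sqrt (1 - e ^ 2) := ⟨_, rfl⟩
    have hr0 : 0 ≤ r := hr ▸ Real.sqrt_nonneg _
    have hr2 : r ^ 2 = 1 - e ^ 2 := by rw [hr, Real.sq_sqrt h1e.le]
    have hr1 : r < 1 := by nlinarith [sq_pos_of_pos he]
    have hsc := Real.sq_sqrt hc.le
    have hscp := Real.sqrt_pos.2 hc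
    have hB : 2 * ss * σ * r < σ ^ 2 + ss ^ 2 - p ^ 2 := by
      rw [Real.sqrt_mul hc.le, ← hr] at hT
      rw [max_assoc, max_eq_right (by positivity : 0 ≤ σ * Real.sqrt c)] at hss
      rcases max_choice (σ - p) (σ * Real.sqrt c) with h1 | h1
      · rw [h1] at hss
        have : 0 < ss * σ * (1 - r) := mul_pos (mul_pos hss0 hσ) (by linarith)
        have e2 : σ ^ 2 + ss ^ 2 - p ^ 2 = 2 * σ * ss := by rw [hss]; ring
        rw [e2]; nlinarith
      · rw [h1] at hss
        rw [hss, mul_pow, hsc]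
        nlinarith
    obtain ⟨B, hBd⟩ : ∃ B, B = σ ^ 2 + ss ^ 2 - p ^ 2 := ⟨_, rfl⟩
    rw [← hBd] at hB
    have hB0 : 0 < B := lt_of_le_of_lt (by positivity) hB
    refine ⟨B / (2 * ss ^ 2), by positivity, ?_⟩
    unfold auxD
    apply div_pos _ (by positivity)
    apply lt_of_lt_of_le _ (le_max_left _ _)
    rw [sub_pos, Real.sqrt_lt' (by positivity), ← hBd]
    have e3 : σ ^ 2 - B / (2 * ss ^ 2) * B + (B / (2 * ss ^ 2)) ^ 2 * ss ^ 2
        = σ ^ 2 - (B / (2 * ss)) ^ 2 := by field_simp; ring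
    rw [e3]
    have h5 : σ * r < B / (2 * ss) := by
      rw [lt_div_iff₀ (by positivity)]; linarith
    have h6 : (σ * r) ^ 2 < (B / (2 * ss)) ^ 2 := by gcongr
    have h7 : (σ * r) ^ 2 = σ ^ 2 - (σ * e) ^ 2 := by rw [mul_pow, hr2]; ring
    linarith

/-- No improvement at the minimizer when the condition fails. -/
lemma no_alpha {σ c e p ss : ℝ} (hσ : 0 < σ) (hc : 0 < c) (he : 0 ≤ e)
    (hce : e ^ 2 ≤ 1 - c) (hp : 0 ≤ p)
    (hss : ss = max (max (σ - p) 0)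
      (Real.sqrt (c * σ ^ 2 + (max (σ * e - p) 0) ^ 2)))
    (hn : ¬ (0 < e ∧ e ^ 2 < 1 - c ∧ 0 < p ∧
      p ^ 2 < σ ^ 2 * (1 + c - 2 * Real.sqrt (c * (1 - e ^ 2))))) (α : ℝ) (hα : 0 < α) :
    auxD σ e (p ^ 2) ss α ≤ max (σ * e - p) 0 := by
  have he1 : e ≤ 1 := by nlinarith
  have h1e : 0 ≤ 1 - e ^ 2 := by linarith
  have hsc := Real.sq_sqrt hc.le
  have hscp := Real.sqrt_pos.2 hc
  have hnn : 0 < c * σ ^ 2 + (max (σ * e - p) 0) ^ 2 := by positivity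
  rcases he.eq_or_lt with he0 | he0
  · have : auxD σ e (p ^ 2) ss α = 0 := by
      unfold auxD
      rw [← he0, mul_zero, zero_sub, max_eq_right (neg_nonpos.2 (Real.sqrt_nonneg _)), zero_div]
    rw [this]; exact le_max_right _ _
  rcases hp.eq_or_lt with hp0 | hp0
  · apply auxD_le_stat he he1 hα
    have : ss = σ := by
      rw [hss, ← hp0, sub_zero, max_eq_left hσ.le, max_eq_left]
      apply Real.sqrt_le_iff.2 ⟨hσ.le, ?_⟩
      rw [sub_zero, max_eq_left (by positivity)]
      nlinarith [sq_pos_of_pos hσ]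
    rw [this, ← hp0]; ring
  rcases le_or_gt (σ ^ 2 * (1 + c - 2 * Real.sqrt (c * (1 - e ^ 2)))) (p ^ 2) with hT | hT
  · obtain ⟨r, hr⟩ : ∃ r, r = Real.sqrt (1 - e ^ 2) := ⟨_, rfl⟩
    obtain ⟨k, hk⟩ : ∃ k, k = Real.sqrt c := ⟨_, rfl⟩
    have hr0 : 0 ≤ r := hr ▸ Real.sqrt_nonneg _
    have hr2 : r ^ 2 = 1 - e ^ 2 := by rw [hr, Real.sq_sqrt h1e]
    have hr1 : r ≤ 1 := by nlinarith [sq_nonneg e]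
    rw [Real.sqrt_mul hc.le, ← hr, ← hk] at hT
    rw [← hk] at hsc hscp
    have hpe : σ * e ≤ p := by
      refine le_of_abs_le (abs_le_of_sq_le_sq ?_ hp)
      nlinarith [mul_nonneg (sq_nonneg σ) (sq_nonneg (k - r))]
    have hpk : σ - p ≤ σ * k := by
      have : σ * (1 - k) ≤ p := by
        refine le_of_abs_le (abs_le_of_sq_le_sq ?_ hp)
        have : 0 ≤ σ ^ 2 * (k * (1 - r)) :=
          mul_nonneg (sq_nonneg σ) (mul_nonneg hscp.le (by linarith))
        nlinarith
      linarith
    have hd : max (σ * e - p) 0 = 0 := max_eq_right (by linarith)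
    rw [hd] at hss ⊢
    have hce' : Real.sqrt (c * σ ^ 2 + 0 ^ 2) = σ * k := by
      rw [zero_pow two_ne_zero, add_zero, Real.sqrt_mul hc.le, Real.sqrt_sq hσ.le, mul_comm, hk]
    rw [hce', max_eq_right (max_le hpk (by positivity))] at hss
    unfold auxD
    rw [max_eq_right, zero_div]
    rw [sub_nonpos]
    apply Real.le_sqrt_of_sq_le
    -- q ≥ σ² - 2ασ² k r + α² σ² k²  ≥ σ² (1 - r²)
    rw [hss]
    have h8 : α * (σ ^ 2 + (σ * k) ^ 2 - p ^ 2) ≤ α * (2 * σ ^ 2 * (k * r)) := by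
      gcongr
      nlinarith
    nlinarith [sq_nonneg (σ * (α * k - r))]
  · have hce2 : e ^ 2 = 1 - c := by
      by_contra hne
      exact hn ⟨he0, lt_of_le_of_ne hce hne, hp0, hT⟩
    have hpe : p < σ * e := by
      have : c * (1 - e ^ 2) = c ^ 2 := by rw [hce2]; ring
      rw [this, Real.sqrt_sq hc.le] at hT
      apply lt_of_pow_lt_pow_left₀ 2 (by positivity)
      rw [mul_pow, hce2]; nlinarith
    have hd : max (σ * e - p) 0 = σ * e - p := max_eq_left (by linarith)
    apply auxD_le_stat he he1 hα
    rw [hd] at hss hnn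
    have hpσ : p < σ := by nlinarith
    have e5 : c * σ ^ 2 + (σ * e - p) ^ 2 = σ ^ 2 + p ^ 2 - 2 * σ * e * p := by
      have : c = 1 - e ^ 2 := by linarith
      rw [this]; ring
    rw [e5] at hss hnn
    rw [max_eq_left (by linarith : (0:ℝ) ≤ σ - p), max_eq_right] at hss
    · rw [hss, Real.sq_sqrt hnn.le]
    · apply Real.le_sqrt_of_sq_le
      have : 0 ≤ σ * p * (1 - e) := by
          apply mul_nonneg (mul_nonneg hσ.le hp); linarith
      nlinarith

lemma aux_main {σ c e P : ℝ} (hσ : 0 < σ) (hc : 0 ≤ c) (he : 0 ≤ e)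
    (hce : e ^ 2 ≤ 1 - c) (hP : 0 ≤ P) :
    sInf ((fun s => auxF σ c s (max (σ * e - Real.sqrt P) 0)) ''
        Set.Icc (max (σ - Real.sqrt P) 0) σ) <
      sInf ((fun s => sSup ((fun α => auxF σ c s (auxD σ e P s α)) '' Set.Ioi 0)) ''
        Set.Icc (max (σ - Real.sqrt P) 0) σ) ↔
    (0 < c ∧ 0 < e ∧ e ^ 2 < 1 - c ∧ 0 < P ∧
      P < σ ^ 2 * (1 + c - 2 * Real.sqrt (c * (1 - e ^ 2)))) := by
  obtain ⟨p, hp⟩ : ∃ p, p = Real.sqrt P := ⟨_, rfl⟩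
  have hp0 : 0 ≤ p := hp ▸ Real.sqrt_nonneg _
  have hpP : P = p ^ 2 := by rw [hp, Real.sq_sqrt hP]
  rw [← hp]
  obtain ⟨d, hd⟩ : ∃ d, d = max (σ * e - p) 0 := ⟨_, rfl⟩
  obtain ⟨lo, hlo⟩ : ∃ lo, lo = max (σ - p) 0 := ⟨_, rfl⟩
  obtain ⟨ss, hss⟩ : ∃ ss, ss = max lo (Real.sqrt (c * σ ^ 2 + d ^ 2)) := ⟨_, rfl⟩
  have he1 : e ≤ 1 := by nlinarith
  have hd0 : 0 ≤ d := hd ▸ le_max_right _ _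
  have hlo0 : 0 ≤ lo := hlo ▸ le_max_right _ _
  have hdlo : d ≤ lo := by
    rw [hd, hlo]
    apply max_le_max _ le_rfl
    nlinarith
  have hdse : d ≤ σ * e := by
    rw [hd]; exact max_le (by linarith) (by positivity)
  have hloσ : lo ≤ σ := by rw [hlo]; exact max_le (by linarith) hσ.le
  have hmem : ss ∈ Set.Icc lo σ := by
    refine ⟨hss ▸ le_max_left _ _, ?_⟩
    rw [hss]
    apply max_le hloσ
    apply Real.sqrt_le_iff.2 ⟨hσ.le, ?_⟩
    have : d ^ 2 ≤ (σ * e) ^ 2 := by gcongr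
    nlinarith [sq_pos_of_pos hσ]
  have hmin : ∀ s ∈ Set.Icc lo σ, s ≠ ss → auxF σ c ss d < auxF σ c s d :=
    fun s hs hne => auxF_min hσ hc hlo0 hd0 hdlo hss hs.1 hne
  have hmin' : ∀ s ∈ Set.Icc lo σ, auxF σ c ss d ≤ auxF σ c s d := by
    intro s hs
    by_cases h : s = ss
    · rw [h]
    · exact (hmin s hs h).le
  rw [← hd, ← hlo]
  have hD : sInf ((fun s => auxF σ c s d) '' Set.Icc lo σ) = auxF σ c ss d := by
    apply IsLeast.csInf_eq
    refine ⟨⟨ss, hmem, rfl⟩, ?_⟩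
    rintro _ ⟨s, hs, rfl⟩
    exact hmin' s hs
  rw [hD]
  have hbdd : ∀ s, BddAbove ((fun α => auxF σ c s (auxD σ e P s α)) '' Set.Ioi 0) := by
    intro s
    refine ⟨σ ^ 2 + s ^ 2, ?_⟩
    rintro _ ⟨α, -, rfl⟩
    simp only [auxF]
    have := mul_nonneg hσ.le (Real.sqrt_nonneg (c * (s ^ 2 - auxD σ e P s α ^ 2)))
    linarith
  have hle : ∀ s α, 0 < α → auxF σ c s (auxD σ e P s α) ≤
      sSup ((fun α => auxF σ c s (auxD σ e P s α)) '' Set.Ioi 0) :=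
    fun s α hα => le_csSup (hbdd s) ⟨α, hα, rfl⟩
  have hle1 : ∀ s, auxF σ c s d ≤
      sSup ((fun α => auxF σ c s (auxD σ e P s α)) '' Set.Ioi 0) := by
    intro s
    have := hle s 1 one_pos
    rwa [auxD_one, ← hp, ← hd] at this
  constructor
  · intro hlt
    by_contra hn
    refine absurd hlt (not_lt.2 ?_)
    have hb : BddBelow ((fun s => sSup ((fun α => auxF σ c s (auxD σ e P s α)) '' Set.Ioi 0)) ''
        Set.Icc lo σ) := by
      refine ⟨auxF σ c ss d, ?_⟩
      rintro _ ⟨s, hs, rfl⟩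
      exact (hmin' s hs).trans (hle1 s)
    refine (csInf_le hb ⟨ss, hmem, rfl⟩).trans ?_
    apply csSup_le (Set.nonempty_Ioi.image _)
    rintro _ ⟨α, hα, rfl⟩
    rcases hc.eq_or_lt with h0 | h0
    · simp [auxF, ← h0]
    · have hα' : 0 < α := hα
      apply auxF_mono hσ hc
      · unfold auxD; positivity
      · rw [hpP, hd]
        apply no_alpha hσ h0 he hce hp0 (by rw [hss, hlo, hd]) _ α hα
        rintro ⟨a1, a2, a3, a4⟩
        apply hn
        rw [hpP]
        exact ⟨h0, a1, a2, by positivity, a4⟩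
  · rintro ⟨h0, a1, a2, a3, a4⟩
    have hp1 : 0 < p := hp ▸ Real.sqrt_pos.2 a3
    obtain ⟨α, hα, hαd⟩ := exists_alpha (ss := ss) hσ h0 a1 a2 hp1 (hpP ▸ a4)
      (by rw [hss, hlo, hd])
    rw [← hd, ← hpP] at hαd
    have hcont : ContinuousOn (fun s => max (auxF σ c s d) (auxF σ c s (auxD σ e P s α)))
        (Set.Icc lo σ) := by
      apply Continuous.continuousOn
      unfold auxF auxD
      fun_prop
    obtain ⟨s1, hs1, hs1m⟩ := isCompact_Icc.exists_isMinOn ⟨ss, hmem⟩ hcont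
    have hgt : auxF σ c ss d < max (auxF σ c s1 d) (auxF σ c s1 (auxD σ e P s1 α)) := by
      by_cases h : s1 = ss
      · rw [h]
        apply lt_max_of_lt_right
        apply auxF_strict hσ h0 hd0 hαd
        have h1 : Real.sqrt (c * σ ^ 2 + d ^ 2) ≤ ss := hss ▸ le_max_right _ _
        have h2 := (Real.sqrt_le_iff.1 h1).2
        have : 0 < c * σ ^ 2 := by positivity
        linarith
      · exact lt_max_of_lt_left (hmin s1 hs1 h)
    refine hgt.trans_le ?_
    apply le_csInf (Set.Nonempty.image _ ⟨ss, hmem⟩)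
    rintro _ ⟨s, hs, rfl⟩
    exact (hs1m hs).trans (max_le (hle1 s) (hle s α hα))

lemma expNeg_nonneg (x : ℝ≥0∞) : 0 ≤ expNeg x := by
  unfold expNeg; split_ifs <;> positivity

lemma expNeg_two_mul (x : ℝ≥0∞) : expNeg (2 * x) = expNeg x ^ 2 := by
  by_cases h : x = ⊤
  · simp [expNeg, h, ENNReal.mul_top]
  · have : 2 * x ≠ ⊤ := ENNReal.mul_ne_top (by simp) h
    simp only [expNeg, h, this, if_false, ENNReal.toReal_mul, ENNReal.toReal_ofNat]
    rw [← Real.exp_nat_mul]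
    congr 1
    push_cast
    ring

lemma expNeg_add (x y : ℝ≥0∞) : expNeg (x + y) = expNeg x * expNeg y := by
  by_cases hx : x = ⊤
  · simp [expNeg, hx]
  by_cases hy : y = ⊤
  · simp [expNeg, hy]
  simp only [expNeg, hx, hy, ENNReal.add_eq_top, or_self, if_false]
  rw [← Real.exp_add, ENNReal.toReal_add hx hy]
  congr 1
  ring

lemma expNeg_le_one (x : ℝ≥0∞) : expNeg x ≤ 1 := by
  unfold expNeg
  split_ifs
  · norm_num
  · rw [Real.exp_le_one_iff]; simp

lemma expNeg_pos_iff (x : ℝ≥0∞) : 0 < expNeg x ↔ x ≠ ⊤ := by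
  unfold expNeg
  split_ifs with h
  · simp [h]
  · simp [h, Real.exp_pos]

lemma expNeg_lt_one_iff (x : ℝ≥0∞) : expNeg x < 1 ↔ 0 < x := by
  unfold expNeg
  split_ifs with h
  · simp [h]
  · rw [Real.exp_lt_one_iff, neg_lt_zero, ENNReal.toReal_pos_iff]
    simp [lt_top_iff_ne_top, h]

/-- Exact characterization of when the improved lower bound is strictly better. -/
theorem stmt10 (σX : ℝ) (hσX : 0 < σX) (R Rc : ℝ≥0∞) (P : ℝ) (hP : 0 ≤ P) :
    DlowerPrime σX R Rc P > DlowerW2 σX R Rc P ↔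
      (0 < R ∧ R ≠ ⊤ ∧ 0 < Rc ∧ Rc ≠ ⊤ ∧ 0 < P ∧
        P < σX ^ 2 * (2 - expNeg (2 * R) - 2 * xiRRc R Rc)) := by
  have hR0 := expNeg_nonneg R
  have hR1 := expNeg_le_one R
  have hC0 := expNeg_nonneg Rc
  have hC1 := expNeg_le_one Rc
  have key := aux_main (σ := σX) (c := 1 - expNeg (2 * R)) (e := expNeg (R + Rc)) (P := P) hσX
    (by rw [expNeg_two_mul]; nlinarith) (expNeg_nonneg _)
    (by
      rw [expNeg_two_mul, expNeg_add, mul_pow]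
      have : expNeg Rc ^ 2 ≤ 1 := by nlinarith
      nlinarith [sq_nonneg (expNeg R)]) hP
  refine Iff.trans key ?_
  have e1 : (1 + (1 - expNeg (2 * R)) -
      2 * Real.sqrt ((1 - expNeg (2 * R)) * (1 - expNeg (R + Rc) ^ 2))) =
      2 - expNeg (2 * R) - 2 * xiRRc R Rc := by
    rw [xiRRc, expNeg_two_mul (R + Rc)]; ring
  rw [e1]
  have i1 : 0 < 1 - expNeg (2 * R) ↔ 0 < R := by
    rw [sub_pos, expNeg_lt_one_iff]; simp
  rw [i1, expNeg_pos_iff, ENNReal.add_ne_top, expNeg_two_mul, expNeg_add]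
  have i2 : R ≠ ⊤ → ((expNeg R * expNeg Rc) ^ 2 < 1 - (1 - expNeg R ^ 2) ↔ 0 < Rc) := by
    intro hR
    rw [← expNeg_pos_iff] at hR
    rw [← expNeg_lt_one_iff, sub_sub_cancel, pow_lt_pow_iff_left₀ (by positivity) hR0 two_ne_zero,
      mul_lt_iff_lt_one_right hR]
  constructor
  · rintro ⟨a, ⟨b, b'⟩, c, d⟩
    exact ⟨a, b, (i2 b).1 c, b', d⟩
  · rintro ⟨a, b, c, b', d⟩
    exact ⟨a, ⟨b, b'⟩, (i2 b).2 c, d⟩
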